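/- arXiv:1712.07150 — 2 statements merged into one kernel-verified Lean document; each statement's English description precedes it below -/
import Mathlib

section
/- Let Ω ⊆ ℝ² be a bounded convex open set whose boundary contains a line segment ℓ = [p_l, p_r], and suppose ∂Ω makes obtuse angles with ℓ at both endpoints. Suppose f : ∂Ω → ℝ is continuous and on ℓ has humps I_i = [a_i, b_i] (maximal closed subintervals of ℓ on which f is constant equal to e_i and attains a local extremum) satisfying the admissibility condition: dist(a_i, f^{−1}(e_i) ∩ (∂Ω \ I_i)) + dist(b_i, f^{−1}(e_i) ∩ (∂Ω \ I_i)) < |a_i − b_i|, with the nearest points y_i, z_i realizing these distances lying in ∂Ω \ ℓ. Then f restricted to ℓ has only finitely many humps. -/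
open Metric Set
open scoped RealInnerProductSpace

noncomputable section

abbrev Plane := EuclideanSpace ℝ (Fin 2)

/-- `IsHump Ω f a b e` : the closed segment `[a,b]` is a "hump" of `f` on
`∂Ω` with value `e`: a maximal nondegenerate segment on which `f` is constant
equal to `e` and where `f` attains a local maximum or minimum relative to
`∂Ω`. -/
def IsHump (Ω : Set Plane) (f : Plane → ℝ) (a b : Plane) (e : ℝ) : Prop :=
  a ≠ b ∧ segment ℝ a b ⊆ frontier Ω ∧
  (∀ x ∈ segment ℝ a b, f x = e) ∧
  ((∃ ε > (0 : ℝ), ∀ x ∈ frontier Ω, infDist x (segment ℝ a b) < ε → f x ≤ e) ∨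
   (∃ ε > (0 : ℝ), ∀ x ∈ frontier Ω, infDist x (segment ℝ a b) < ε → e ≤ f x)) ∧
  (∀ a' b' : Plane, segment ℝ a b ⊆ segment ℝ a' b' →
    segment ℝ a' b' ⊆ frontier Ω → (∀ x ∈ segment ℝ a' b', f x = e) →
    segment ℝ a' b' = segment ℝ a b)

/-- The kernel of a nonzero functional on the plane is spanned by any of its nonzero elements. -/
theorem eq_smul_of_map_eq_zero {u : StrongDual ℝ Plane} {v d w : Plane} (hw : u w ≠ 0)
    (hv : u v = 0) (hd : u d = 0) (hd0 : d ≠ 0) : v = (⟪v, d⟫ / ⟪d, d⟫) • d := by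
  have hdd : ⟪d, d⟫ ≠ 0 := inner_self_ne_zero.2 hd0
  have hu_eq : ∀ x : Plane, u x = x 0 * u (EuclideanSpace.single 0 1)
      + x 1 * u (EuclideanSpace.single 1 1) := by
    intro x
    conv_lhs => rw [show x = x 0 • EuclideanSpace.single 0 (1 : ℝ)
      + x 1 • EuclideanSpace.single 1 (1 : ℝ) by ext i; fin_cases i <;> simp]
    simp
  have h₁ := hu_eq v
  have h₂ := hu_eq d
  have h₃ := hu_eq w
  rw [hv] at h₁
  rw [hd] at h₂
  set c₀ := u (EuclideanSpace.single 0 1)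
  set c₁ := u (EuclideanSpace.single 1 1)
  have hc : v 0 * d 1 = v 1 * d 0 := by
    by_contra hcon
    have hD : v 0 * d 1 - v 1 * d 0 ≠ 0 := sub_ne_zero.2 hcon
    have e₀ : c₀ = 0 := by
      apply (mul_eq_zero.1 (_ : (v 0 * d 1 - v 1 * d 0) * c₀ = 0)).resolve_left hD
      linear_combination v 1 * h₂ - d 1 * h₁
    have e₁ : c₁ = 0 := by
      apply (mul_eq_zero.1 (_ : (v 0 * d 1 - v 1 * d 0) * c₁ = 0)).resolve_left hD
      linear_combination d 0 * h₁ - v 0 * h₂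
    rw [e₀, e₁] at h₃
    exact hw (by simpa using h₃)
  have hin : ∀ x w : Plane, ⟪x, w⟫ = x 0 * w 0 + x 1 * w 1 := by
    intro x w
    simp [PiLp.inner_apply, Fin.sum_univ_two]
    ring
  rw [hin] at hdd
  ext i
  fin_cases i
  · simp only [hin, Fin.zero_eta, PiLp.smul_apply, smul_eq_mul]
    rw [div_mul_eq_mul_div, eq_div_iff hdd]
    linear_combination d 1 * hc
  · simp only [hin, Fin.mk_one, PiLp.smul_apply, smul_eq_mul]
    rw [div_mul_eq_mul_div, eq_div_iff hdd]
    linear_combination -d 0 * hc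

/-- No boundary points of a convex open set off a boundary segment accumulate at a point of the
relative interior of that segment. -/
theorem eventually_frontier_mem_segment {Ω : Set Plane} (hΩo : IsOpen Ω) (hΩc : Convex ℝ Ω)
    {pl pr p : Plane} (hlr : pl ≠ pr) (hflat : segment ℝ pl pr ⊆ frontier Ω)
    (hp : p ∈ openSegment ℝ pl pr) :
    ∀ᶠ y in nhds p, y ∈ frontier Ω → y ∈ segment ℝ pl pr := by
  have hpF : p ∈ frontier Ω := hflat (openSegment_subset_segment _ _ _ hp)
  have hfr : frontier Ω = closure Ω \ Ω := hΩo.frontier_eq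
  obtain ⟨u, hu⟩ := geometric_hahn_banach_open_point hΩc hΩo (hfr ▸ hpF).2
  have hcl : ∀ x ∈ closure Ω, u x ≤ u p := fun x hx =>
    closure_minimal (fun x hx => (hu x hx).le) (isClosed_le u.continuous continuous_const) hx
  have hl := hcl pl (hfr ▸ hflat (left_mem_segment ℝ pl pr)).1
  have hr := hcl pr (hfr ▸ hflat (right_mem_segment ℝ pl pr)).1
  obtain ⟨q, hq⟩ : Ω.Nonempty := closure_nonempty_iff.1 ⟨p, (hfr ▸ hpF).1⟩
  have huq := hu q hq
  obtain ⟨s₁, s₂, hs₁, hs₂, hs, rfl⟩ := hp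
  set p := s₁ • pl + s₂ • pr with hpdef
  have hup : u p = s₁ * u pl + s₂ * u pr := by simp [hpdef]
  have hud : u (pr - pl) = 0 := by
    rw [map_sub]
    have h₁ : u p = s₁ * u p + s₂ * u p := by rw [← add_mul, hs, one_mul]
    nlinarith [mul_le_mul_of_nonneg_left hl hs₁.le, mul_le_mul_of_nonneg_left hr hs₂.le]
  set d := pr - pl with hd
  have hd0 : d ≠ 0 := sub_ne_zero.2 hlr.symm
  have hpq : u p - u q ≠ 0 := (sub_pos.2 huq).ne'
  have hw : u (p - q) ≠ 0 := by rwa [map_sub]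
  let t : Plane → ℝ := fun y => (u p - u y) / (u p - u q)
  have ht : Continuous t := by fun_prop
  have htp : t p = 0 := by simp [t]
  let s : Plane → Plane := fun y => (1 - t y)⁻¹ • (y - t y • q)
  have hsc : ContinuousAt s p := by
    have hinv : ContinuousAt (fun y => (1 - t y)⁻¹) p :=
      (continuous_const.sub ht).continuousAt.inv₀ (by simp [htp])
    fun_prop
  have hsp : s p = p := by simp [s, htp]
  let c : Plane → ℝ := fun y => ⟪s y - p, d⟫ / ⟪d, d⟫
  have hcc : ContinuousAt c p :=
    ((hsc.sub continuousAt_const).inner continuousAt_const).div_const _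
  have hcp : c p = 0 := by simp [c, hsp]
  have hE₁ : ∀ᶠ y in nhds p, t y < 1 :=
    ht.continuousAt.eventually (gt_mem_nhds (by simp [htp]))
  have hE₂ : ∀ᶠ y in nhds p, -s₂ < c y :=
    hcc.eventually (lt_mem_nhds (by rw [hcp]; linarith))
  have hE₃ : ∀ᶠ y in nhds p, c y < s₁ :=
    hcc.eventually (gt_mem_nhds (by rw [hcp]; linarith))
  filter_upwards [hE₁, hE₂, hE₃] with y h₁ h₂ h₃ hy
  rw [hfr] at hy
  have ht0 : 0 ≤ t y := div_nonneg (sub_nonneg.2 (hcl y hy.1)) (sub_pos.2 huq).le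
  have h1t : 1 - t y ≠ 0 := by linarith
  have hys : y = (1 - t y) • s y + t y • q := by
    simp only [s]
    rw [smul_inv_smul₀ h1t]
    simp
  have hus : u (s y - p) = 0 := by
    have : t y * (u p - u q) = u p - u y := div_mul_cancel₀ _ hpq
    simp only [s, map_sub, map_smul, smul_eq_mul]
    field_simp
    linarith
  have hsy : s y = p + c y • d := by
    rw [← eq_smul_of_map_eq_zero hw hus hud hd0]
    simp
  have hsseg : s y ∈ segment ℝ pl pr := by
    refine ⟨s₁ - c y, s₂ + c y, by linarith, by linarith, by linarith, ?_⟩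
    rw [hsy, hpdef, hd]
    module
  rcases ht0.eq_or_lt with h0 | h0
  · rw [hys, ← h0]
    simpa using hsseg
  · refine absurd ?_ hy.2
    have := hΩc.combo_closure_interior_mem_interior (hfr ▸ hflat hsseg).1
      (hΩo.interior_eq.symm ▸ hq) (by linarith : 0 ≤ 1 - t y) h0 (by ring)
    rw [← hys] at this
    exact interior_subset this

/-- Two humps on a common line which share a point coincide. -/
theorem IsHump.segment_eq_of_mem {Ω : Set Plane} {f : Plane → ℝ} {L : ℝ →ᵃ[ℝ] Plane}
    {α β α' β' e e' t : ℝ} (h : IsHump Ω f (L α) (L β) e) (h' : IsHump Ω f (L α') (L β') e')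
    (ht : t ∈ uIcc α β) (ht' : t ∈ uIcc α' β') :
    segment ℝ (L α) (L β) = segment ℝ (L α') (L β') := by
  obtain ⟨-, hF, hc, -, hm⟩ := h
  obtain ⟨-, hF', hc', -, hm'⟩ := h'
  simp only [← image_segment, segment_eq_uIcc] at *
  have he : e = e' := (hc _ ⟨t, ht, rfl⟩).symm.trans (hc' _ ⟨t, ht', rfl⟩)
  subst he
  set m := min (min α β) (min α' β')
  set M := max (max α β) (max α' β')
  have hmM : m ≤ M := (min_le_left _ _).trans
    ((min_le_left _ _).trans ((le_max_left _ _).trans (le_max_left _ _)))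
  have hU : uIcc m M ⊆ uIcc α β ∪ uIcc α' β' := by
    rw [uIcc_of_le hmM]
    intro x hx
    simp only [uIcc, mem_union, mem_Icc] at *
    grind
  have h₁ : uIcc α β ⊆ uIcc m M := by
    rw [uIcc_of_le hmM]
    exact Icc_subset_Icc (min_le_left _ _) (le_max_left _ _)
  have h₂ : uIcc α' β' ⊆ uIcc m M := by
    rw [uIcc_of_le hmM]
    exact Icc_subset_Icc (min_le_right _ _) (le_max_right _ _)
  have hF'' : L '' uIcc m M ⊆ frontier Ω :=
    (image_mono hU).trans (by rw [image_union]; exact union_subset hF hF')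
  have hc'' : ∀ x ∈ L '' uIcc m M, f x = e := by
    rintro _ ⟨x, hx, rfl⟩
    exact (hU hx).elim (fun hx => hc _ ⟨x, hx, rfl⟩) (fun hx => hc' _ ⟨x, hx, rfl⟩)
  have k := hm (L m) (L M)
  have k' := hm' (L m) (L M)
  simp only [← image_segment, segment_eq_uIcc] at k k'
  exact (k (image_mono h₁) hF'' hc'').symm.trans (k' (image_mono h₂) hF'' hc'')

/-- At an endpoint `P` of `[P, Q]` where the angle is obtuse, `P` is closer to the points of
`[P, Q]` than the points `y` beyond the angle. -/
theorem dist_le_dist_of_inner_nonpos {P Q a y : Plane} (ha : a ∈ segment ℝ P Q)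
    (hy : ⟪y - P, Q - P⟫ ≤ 0) : dist a P ≤ dist a y := by
  rw [segment_eq_image_lineMap] at ha
  obtain ⟨t, ht, rfl⟩ := ha
  rw [AffineMap.lineMap_apply_module', dist_eq_norm, dist_eq_norm]
  have h : ‖t • (Q - P) + P - y‖ ^ 2
      = ‖t • (Q - P) + P - P‖ ^ 2 - 2 * (t * ⟪y - P, Q - P⟫) + ‖y - P‖ ^ 2 := by
    rw [show t • (Q - P) + P - y = t • (Q - P) - (y - P) by abel, norm_sub_sq_real,
      real_inner_smul_left, real_inner_comm, add_sub_cancel_right]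
  refine le_of_sq_le_sq ?_ (norm_nonneg _)
  nlinarith [mul_nonneg ht.1 (neg_nonneg.2 hy), sq_nonneg ‖y - P‖]

/-- An obtuse endpoint is incompatible with admissible humps shrinking to it. -/
theorem false_of_tendsto_endpoint {F : Set Plane} {P Q : Plane}
    (hob : ∃ δ > (0 : ℝ), ∀ q ∈ F \ segment ℝ P Q, dist q P < δ → ⟪q - P, Q - P⟫ ≤ 0)
    {a b y z : ℕ → Plane} (ha : ∀ n, a n ∈ segment ℝ P Q) (hb : ∀ n, b n ∈ segment ℝ P Q)
    (hy : ∀ n, y n ∈ F \ segment ℝ P Q) (hz : ∀ n, z n ∈ F \ segment ℝ P Q)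
    (hadm : ∀ n, dist (a n) (y n) + dist (b n) (z n) < dist (a n) (b n))
    (hyP : Filter.Tendsto y Filter.atTop (nhds P)) (hzP : Filter.Tendsto z Filter.atTop (nhds P)) :
    False := by
  obtain ⟨δ, hδ, h⟩ := hob
  obtain ⟨n, hn, hn'⟩ := ((hyP.eventually (ball_mem_nhds P hδ)).and
    (hzP.eventually (ball_mem_nhds P hδ))).exists
  have h₁ := dist_le_dist_of_inner_nonpos (ha n) (h _ (hy n) hn)
  have h₂ := dist_le_dist_of_inner_nonpos (hb n) (h _ (hz n) hn')
  linarith [hadm n, dist_triangle_right (a n) (b n) P]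

/-- If `Ω` is a bounded convex open planar set, `ℓ = [p_l, p_r]` a flat part of
`∂Ω` meeting the rest of the boundary at obtuse angles at both endpoints, and
`f` continuous on `∂Ω` satisfies the admissibility condition #2 on a family of
humps of `ℓ`, then the family of humps is finite. -/
theorem finitely_many_humps
    (Ω : Set Plane) (hΩo : IsOpen Ω) (hΩb : Bornology.IsBounded Ω)
    (hΩc : Convex ℝ Ω)
    (pl pr : Plane) (hlr : pl ≠ pr)
    (hflat : segment ℝ pl pr ⊆ frontier Ω)
    (hflatmax : ∀ p q : Plane, segment ℝ pl pr ⊆ segment ℝ p q →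
      segment ℝ p q ⊆ frontier Ω → segment ℝ p q = segment ℝ pl pr)
    -- the boundary makes obtuse angles with `ℓ` at both endpoints
    (hobtl : ∃ δ > (0 : ℝ), ∀ q ∈ frontier Ω \ segment ℝ pl pr,
      dist q pl < δ → ⟪q - pl, pr - pl⟫ ≤ 0)
    (hobtr : ∃ δ > (0 : ℝ), ∀ q ∈ frontier Ω \ segment ℝ pl pr,
      dist q pr < δ → ⟪q - pr, pl - pr⟫ ≤ 0)
    (f : Plane → ℝ) (hf : ContinuousOn f (frontier Ω))
    -- the humps of `f` on `ℓ`, with values `e i`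
    (ι : Type) (a b : ι → Plane) (e : ι → ℝ)
    (hhump : ∀ i, IsHump Ω f (a i) (b i) (e i))
    (hsub : ∀ i, segment ℝ (a i) (b i) ⊆ segment ℝ pl pr)
    (hinj : ∀ i j, segment ℝ (a i) (b i) = segment ℝ (a j) (b j) → i = j)
    -- admissibility condition #2, with realizing points `y i`, `z i` off `ℓ`
    (y z : ι → Plane)
    (hy : ∀ i, y i ∈ (f ⁻¹' {e i} ∩ (frontier Ω \ segment ℝ (a i) (b i))) ∧
      dist (a i) (y i) =
        infDist (a i) (f ⁻¹' {e i} ∩ (frontier Ω \ segment ℝ (a i) (b i))))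
    (hz : ∀ i, z i ∈ (f ⁻¹' {e i} ∩ (frontier Ω \ segment ℝ (a i) (b i))) ∧
      dist (b i) (z i) =
        infDist (b i) (f ⁻¹' {e i} ∩ (frontier Ω \ segment ℝ (a i) (b i))))
    (hyz : ∀ i, y i ∉ segment ℝ pl pr ∧ z i ∉ segment ℝ pl pr)
    (hadm : ∀ i, dist (a i) (y i) + dist (b i) (z i) < dist (a i) (b i)) :
    Finite ι := by
  by_contra hinf
  rw [not_finite_iff_infinite] at hinf
  let L : ℝ →ᵃ[ℝ] Plane := AffineMap.lineMap pl pr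
  have hL : segment ℝ pl pr = L '' Icc 0 1 := segment_eq_image_lineMap ℝ pl pr
  have haS : ∀ i, a i ∈ segment ℝ pl pr := fun i => hsub i (left_mem_segment ℝ _ _)
  have hbS : ∀ i, b i ∈ segment ℝ pl pr := fun i => hsub i (right_mem_segment ℝ _ _)
  have hα : ∀ i, ∃ t ∈ Icc (0 : ℝ) 1, L t = a i := fun i => by simpa [hL] using haS i
  have hβ : ∀ i, ∃ t ∈ Icc (0 : ℝ) 1, L t = b i := fun i => by simpa [hL] using hbS i
  choose α hα01 hα using hα
  choose β hβ01 hβ using hβ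
  have hdisj : ∀ i j t, t ∈ uIcc (α i) (β i) → t ∈ uIcc (α j) (β j) → i = j := by
    intro i j t hi hj
    apply hinj
    have h₁ := hhump i
    have h₂ := hhump j
    rw [← hα, ← hβ] at h₁ h₂
    simpa only [hα, hβ] using h₁.segment_eq_of_mem h₂ hi hj
  let g := Infinite.natEmbedding ι
  obtain ⟨⟨A, B⟩, hAB, φ, hφ, hlim⟩ := (isCompact_Icc.prod isCompact_Icc).tendsto_subseq
    (fun n => (⟨hα01 (g n), hβ01 (g n)⟩ :
      (α (g n), β (g n)) ∈ Icc (0 : ℝ) 1 ×ˢ Icc (0 : ℝ) 1))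
  have hlα : Filter.Tendsto (fun n => α (g (φ n))) Filter.atTop (nhds A) :=
    (continuous_fst.tendsto _).comp hlim
  have hlβ : Filter.Tendsto (fun n => β (g (φ n))) Filter.atTop (nhds B) :=
    (continuous_snd.tendsto _).comp hlim
  have hABeq : A = B := by
    by_contra hne
    have hev : ∀ᶠ n in Filter.atTop, (A + B) / 2 ∈ uIcc (α (g (φ n))) (β (g (φ n))) := by
      rcases lt_or_gt_of_ne hne with h | h
      · filter_upwards [hlα.eventually (gt_mem_nhds (by linarith : A < (A + B) / 2)),
          hlβ.eventually (lt_mem_nhds (by linarith : (A + B) / 2 < B))] with n h₁ h₂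
        exact mem_uIcc.2 (Or.inl ⟨h₁.le, h₂.le⟩)
      · filter_upwards [hlα.eventually (lt_mem_nhds (by linarith : (A + B) / 2 < A)),
          hlβ.eventually (gt_mem_nhds (by linarith : B < (A + B) / 2))] with n h₁ h₂
        exact mem_uIcc.2 (Or.inr ⟨h₂.le, h₁.le⟩)
    obtain ⟨N, hN⟩ := Filter.eventually_atTop.1 hev
    have := hφ.injective (g.injective (hdisj _ _ _ (hN N le_rfl) (hN (N + 1) (Nat.le_succ N))))
    omega
  subst hABeq
  have hLc : Continuous L := AffineMap.lineMap_continuous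
  have hla : Filter.Tendsto (fun n => a (g (φ n))) Filter.atTop (nhds (L A)) := by
    simpa only [hα] using (hLc.tendsto A).comp hlα |>.congr fun n => hα (g (φ n))
  have hlb : Filter.Tendsto (fun n => b (g (φ n))) Filter.atTop (nhds (L A)) := by
    simpa only [hβ] using (hLc.tendsto A).comp hlβ |>.congr fun n => hβ (g (φ n))
  have hlab : Filter.Tendsto (fun n => dist (a (g (φ n))) (b (g (φ n)))) Filter.atTop (nhds 0) := by
    simpa using hla.dist hlb
  have hly : Filter.Tendsto (fun n => y (g (φ n))) Filter.atTop (nhds (L A)) :=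
    (tendsto_iff_of_dist (squeeze_zero (fun _ => dist_nonneg) (fun n => by
      linarith [hadm (g (φ n)), dist_nonneg (x := b (g (φ n))) (y := z (g (φ n)))]) hlab)).1 hla
  have hlz : Filter.Tendsto (fun n => z (g (φ n))) Filter.atTop (nhds (L A)) :=
    (tendsto_iff_of_dist (squeeze_zero (fun _ => dist_nonneg) (fun n => by
      linarith [hadm (g (φ n)), dist_nonneg (x := a (g (φ n))) (y := y (g (φ n)))]) hlab)).1 hlb
  have hyF : ∀ i, y i ∈ frontier Ω \ segment ℝ pl pr := fun i => ⟨(hy i).1.2.1, (hyz i).1⟩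
  have hzF : ∀ i, z i ∈ frontier Ω \ segment ℝ pl pr := fun i => ⟨(hz i).1.2.1, (hyz i).2⟩
  have hp : L A ∈ segment ℝ pl pr := hL ▸ mem_image_of_mem L hAB.1
  rw [← insert_endpoints_openSegment] at hp
  rcases hp with hp | hp | hp
  · rw [hp] at hly hlz
    exact false_of_tendsto_endpoint hobtl (fun n => haS _) (fun n => hbS _) (fun n => hyF _)
      (fun n => hzF _) (fun n => hadm (g (φ n))) hly hlz
  · rw [hp] at hly hlz
    simp only [segment_symm ℝ pl pr] at haS hbS hyF hzF hobtr
    exact false_of_tendsto_endpoint hobtr (fun n => haS _) (fun n => hbS _) (fun n => hyF _)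
      (fun n => hzF _) (fun n => hadm (g (φ n))) hly hlz
  · obtain ⟨n, hn⟩ :=
      (hly.eventually (eventually_frontier_mem_segment hΩo hΩc hlr hflat hp)).exists
    exact (hyF _).2 (hn (hyF _).1)
end
end

section
/- Let f₁, f₂ be continuous functions on ∂Ω of a bounded convex Ω ⊆ ℝ², both satisfying the admissibility conditions, with f₁ ≤ f₂ pointwise. If u₁, u₂ are the corresponding (continuous) solutions to the least gradient problem with traces f₁ and f₂ obtained as pointwise limits of solutions on strictly convex approximating domains, then u₁ ≤ u₂ in Ω. -/
open MeasureTheory Metric Set Filter Topology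

noncomputable section

/-- The divergence of a vector field on the plane. -/
def divg (φ : Plane → Plane) (x : Plane) : ℝ :=
  fderiv ℝ φ x (EuclideanSpace.single 0 1) 0 +
    fderiv ℝ φ x (EuclideanSpace.single 1 1) 1

/-- The set of test values defining the total variation of `u` on `Ω`:
`∫_Ω u div φ` over `C¹` vector fields `φ` compactly supported in `Ω` with
`‖φ‖ ≤ 1`. -/
def TVtest (Ω : Set Plane) (u : Plane → ℝ) : Set ℝ :=
  {r | ∃ φ : Plane → Plane, ContDiff ℝ 1 φ ∧ HasCompactSupport φ ∧
      tsupport φ ⊆ Ω ∧ (∀ x, ‖φ x‖ ≤ 1) ∧ r = ∫ x in Ω, u x * divg φ x}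

/-- `u` has bounded variation on `Ω`. -/
def BVOn (u : Plane → ℝ) (Ω : Set Plane) : Prop :=
  IntegrableOn u Ω volume ∧ BddAbove (TVtest Ω u)

/-- The total variation `∫_Ω |Du|`. -/
def totalVar (Ω : Set Plane) (u : Plane → ℝ) : ℝ :=
  sSup (TVtest Ω u)

/-- `u` is a function of least gradient on `Ω`: its total variation does not
exceed that of any compactly supported BV perturbation. -/
def LeastGradientOn (u : Plane → ℝ) (Ω : Set Plane) : Prop :=
  BVOn u Ω ∧ ∀ φ : Plane → ℝ, BVOn φ Ω → HasCompactSupport φ →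
    tsupport φ ⊆ Ω → totalVar Ω u ≤ totalVar Ω (u + φ)

/-- `u` attains the boundary datum `f` in the (continuous-limit) trace sense. -/
def HasTraceOn (u : Plane → ℝ) (Ω : Set Plane) (f : Plane → ℝ) : Prop :=
  ∀ p ∈ frontier Ω, Tendsto u (𝓝[Ω] p) (𝓝 (f p))

lemma divg_add {X Y : Plane → Plane} (hX : ContDiff ℝ 1 X) (hY : ContDiff ℝ 1 Y) (x : Plane) :
    divg (fun y => X y + Y y) x = divg X x + divg Y x := by
  have := fderiv_fun_add (hX.differentiable one_ne_zero x) (hY.differentiable one_ne_zero x)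
  simp only [divg, this, add_apply, PiLp.add_apply]
  ring

lemma divg_neg (X : Plane → Plane) (x : Plane) : divg (fun y => -X y) x = -divg X x := by
  simp only [divg, fderiv_fun_neg, neg_apply, PiLp.neg_apply]
  ring

lemma divg_sub {X Y : Plane → Plane} (hX : ContDiff ℝ 1 X) (hY : ContDiff ℝ 1 Y) (x : Plane) :
    divg (fun y => X y - Y y) x = divg X x - divg Y x := by
  simp only [sub_eq_add_neg, divg_add hX hY.neg, divg_neg]

lemma divg_smul {a : Plane → ℝ} {X : Plane → Plane} (ha : ContDiff ℝ 1 a) (hX : ContDiff ℝ 1 X)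
    (x : Plane) :
    divg (fun y => a y • X y) x = a x * divg X x +
      (fderiv ℝ a x (EuclideanSpace.single 0 1) * X x 0 +
        fderiv ℝ a x (EuclideanSpace.single 1 1) * X x 1) := by
  have := fderiv_fun_smul (ha.differentiable one_ne_zero x) (hX.differentiable one_ne_zero x)
  simp only [divg, this, add_apply, PiLp.add_apply,
    smul_apply, ContinuousLinearMap.smulRight_apply, PiLp.smul_apply,
    smul_eq_mul]
  ring

lemma divg_comp_add_right (X : Plane → Plane) (y x : Plane) :
    divg (fun z => X (z + y)) x = divg X (x + y) := by
  simp only [divg, fderiv_comp_add_right]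

lemma continuous_divg {X : Plane → Plane} (hX : ContDiff ℝ 1 X) : Continuous (divg X) := by
  have h := hX.continuous_fderiv one_ne_zero
  have hcoord (i j : Fin 2) : Continuous fun x => fderiv ℝ X x (EuclideanSpace.single i 1) j :=
    (EuclideanSpace.proj j : Plane →L[ℝ] ℝ).continuous.comp
      (h.clm_apply continuous_const)
  exact (hcoord 0 0).add (hcoord 1 1)

lemma divg_eq_zero_of_notMem_tsupport {X : Plane → Plane} {x : Plane} (hx : x ∉ tsupport X) :
    divg X x = 0 := by
  have : fderiv ℝ X x = 0 :=
    image_eq_zero_of_notMem_tsupport fun h => hx (tsupport_fderiv_subset ℝ h)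
  simp [divg, this]

lemma hasCompactSupport_divg {X : Plane → Plane} (hX : HasCompactSupport X) :
    HasCompactSupport (divg X) :=
  HasCompactSupport.intro hX fun _ hx => divg_eq_zero_of_notMem_tsupport hx

lemma integrable_mul_divg {u : Plane → ℝ} {X : Plane → Plane} {μ : Measure Plane}
    (hu : Integrable u μ) (hX : ContDiff ℝ 1 X) (hc : HasCompactSupport X) :
    Integrable (fun x => u x * divg X x) μ := by
  obtain ⟨C, hC⟩ := (continuous_divg hX).bounded_above_of_compact_support
    (hasCompactSupport_divg hc)
  exact hu.mul_bdd (continuous_divg hX).aestronglyMeasurable (ae_of_all _ hC)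

lemma integrable_continuous_mul_divg {a : Plane → ℝ} {X : Plane → Plane} (ha : Continuous a)
    (hX : ContDiff ℝ 1 X) (hc : HasCompactSupport X) :
    Integrable fun x => a x * divg X x :=
  Continuous.integrable_of_hasCompactSupport (ha.mul (continuous_divg hX))
    ((hasCompactSupport_divg hc).mul_left (f := a))

lemma integrable_divg {X : Plane → Plane} (hX : ContDiff ℝ 1 X) (hc : HasCompactSupport X) :
    Integrable (divg X) :=
  (continuous_divg hX).integrable_of_hasCompactSupport (hasCompactSupport_divg hc)

lemma integral_fderiv_apply_eq_zero {g : Plane → ℝ} (hg : ContDiff ℝ 1 g)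
    (hc : HasCompactSupport g) (v : Plane) : ∫ x, fderiv ℝ g x v = 0 := by
  have h1 : Integrable fun x => fderiv ℝ g x v :=
    ((hg.continuous_fderiv one_ne_zero).clm_apply continuous_const).integrable_of_hasCompactSupport
      (hc.fderiv_apply ℝ v)
  have h := integral_mul_fderiv_eq_neg_fderiv_mul_of_integrable (μ := (volume : Measure Plane))
    (f := fun _ : Plane => (1 : ℝ)) (g := g) (v := v) (by simp) (by simpa using h1)
    (by simpa using hg.continuous.integrable_of_hasCompactSupport hc)
    (fun _ _ => differentiableAt_const _) (fun x _ => hg.differentiable one_ne_zero x)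
  simpa using h

lemma integral_divg_eq_zero {X : Plane → Plane} (hX : ContDiff ℝ 1 X)
    (hc : HasCompactSupport X) : ∫ x, divg X x = 0 := by
  have hd (j : Fin 2) : ContDiff ℝ 1 fun x => X x j :=
    (EuclideanSpace.proj j : Plane →L[ℝ] ℝ).contDiff.comp hX
  have hcs (j : Fin 2) : HasCompactSupport fun x => X x j :=
    hc.comp_left (g := fun v : Plane => v j) rfl
  have key (j : Fin 2) (v x : Plane) : fderiv ℝ X x v j = fderiv ℝ (fun y => X y j) x v := by
    have := ((EuclideanSpace.proj j : Plane →L[ℝ] ℝ).hasFDerivAt.comp x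
      (hX.differentiable one_ne_zero x).hasFDerivAt).fderiv
    exact (congrArg (fun L => L v) this).symm
  have hi (j : Fin 2) (v : Plane) : Integrable fun x => fderiv ℝ (fun y => X y j) x v :=
    (((hd j).continuous_fderiv one_ne_zero).clm_apply
      continuous_const).integrable_of_hasCompactSupport ((hcs j).fderiv_apply ℝ v)
  simp only [divg, key]
  rw [integral_add (hi _ _) (hi _ _), integral_fderiv_apply_eq_zero (hd 0) (hcs 0),
    integral_fderiv_apply_eq_zero (hd 1) (hcs 1), add_zero]

open scoped Convolution

lemma integral_convolution_mul_divg_le {Ω : Set Plane} {u : Plane → ℝ} {T : ℝ}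
    (hΩ : MeasurableSet Ω) (hu : IntegrableOn u Ω) (hT : ∀ r ∈ TVtest Ω u, r ≤ T)
    (ρ : ContDiffBump (0 : Plane)) {X : Plane → Plane} (hX : ContDiff ℝ 1 X)
    (hc : HasCompactSupport X) (hsub : cthickening ρ.rOut (tsupport X) ⊆ Ω)
    (hX1 : ∀ x, ‖X x‖ ≤ 1) :
    ∫ x, (ρ.normed volume ⋆[ContinuousLinearMap.lsmul ℝ ℝ, volume] Ω.indicator u) x * divg X x
      ≤ T := by
  set U := Ω.indicator u
  set η := ρ.normed (volume : Measure Plane)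
  have hU : Integrable U := hu.integrable_indicator hΩ
  have hη : Integrable η := ρ.integrable_normed
  obtain ⟨C, hC⟩ := (continuous_divg hX).bounded_above_of_compact_support
    (hasCompactSupport_divg hc)
  have hF : Integrable (fun p : Plane × Plane => η p.2 * U (p.1 - p.2) * divg X p.1)
      (volume.prod volume) :=
    (hη.convolution_integrand (ContinuousLinearMap.lsmul ℝ ℝ) hU).mul_bdd
      ((continuous_divg hX).comp continuous_fst).aestronglyMeasurable
      (ae_of_all _ fun p => hC p.1)
  have htrans (t : Plane) :
      ∫ x, η t * U (x - t) * divg X x = η t * ∫ x, U x * divg X (x + t) := by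
    rw [← integral_const_mul, ← integral_sub_right_eq_self (fun x => η t * (U x * divg X (x + t))) t]
    simp only [sub_add_cancel, mul_assoc]
  have hle (t : Plane) : η t * ∫ x, U x * divg X (x + t) ≤ η t * T := by
    by_cases ht : t ∈ Function.support η
    swap
    · simp [Function.notMem_support.1 ht]
    refine mul_le_mul_of_nonneg_left (hT _ ?_) (ρ.nonneg_normed t)
    have htr : ‖t‖ < ρ.rOut := by
      simpa [η, ρ.support_normed_eq] using ht
    refine ⟨fun x => X (x + t), hX.comp (contDiff_id.add contDiff_const),
      hc.comp_homeomorph (Homeomorph.addRight t), ?_, fun x => hX1 _, ?_⟩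
    · intro x hx
      have hxt : x + t ∈ tsupport X :=
        tsupport_comp_subset_preimage X (f := fun y : Plane => y + t) (by fun_prop) hx
      refine hsub (mem_cthickening_of_dist_le x (x + t) _ _ hxt ?_)
      simpa [dist_eq_norm] using htr.le
    · rw [← integral_indicator hΩ]
      refine integral_congr_ae (ae_of_all _ fun x => ?_)
      by_cases hx : x ∈ Ω <;> simp [U, hx, divg_comp_add_right]
  calc ∫ x, (η ⋆[ContinuousLinearMap.lsmul ℝ ℝ, volume] U) x * divg X x
      = ∫ x, ∫ t, η t * U (x - t) * divg X x := by
        simp only [integral_mul_const]; rfl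
    _ = ∫ t, ∫ x, η t * U (x - t) * divg X x := integral_integral_swap hF
    _ = ∫ t, η t * ∫ x, U x * divg X (x + t) := by simp only [htrans]
    _ ≤ ∫ t, η t * T := by
        refine integral_mono ?_ (hη.mul_const T) hle
        simpa only [htrans] using hF.integral_prod_right
    _ = T := by rw [integral_mul_const, ρ.integral_normed, one_mul]

lemma integral_mul_divg_comp_smul {w : Plane → ℝ} {χ : Plane → Plane} {H h : ℝ → ℝ}
    (hw : ContDiff ℝ 1 w) (hχ : ContDiff ℝ 1 χ) (hc : HasCompactSupport χ)
    (hh : ContDiff ℝ 1 h) (hHC : ContDiff ℝ 1 H) (hH : ∀ t, HasDerivAt H (h t) t) :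
    ∫ x, w x * divg (fun y => h (w y) • χ y) x = ∫ x, H (w x) * divg χ x := by
  have ha : ContDiff ℝ 1 fun y => h (w y) := hh.comp hw
  have hb : ContDiff ℝ 1 fun y => H (w y) := hHC.comp hw
  have haχ : ContDiff ℝ 1 fun y => h (w y) • χ y := ha.smul hχ
  have hbχ : ContDiff ℝ 1 fun y => H (w y) • χ y := hb.smul hχ
  have hwaχ : ContDiff ℝ 1 fun y => w y • h (w y) • χ y := hw.smul haχ
  have hcs (a : Plane → ℝ) : HasCompactSupport fun y => a y • χ y :=
    hc.smul_left (f := a)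
  have hD (x : Plane) : fderiv ℝ (fun y => H (w y)) x = h (w x) • fderiv ℝ w x :=
    ((hH (w x)).comp_hasFDerivAt x (hw.differentiable one_ne_zero x).hasFDerivAt).fderiv
  have key (x : Plane) : w x * divg (fun y => h (w y) • χ y) x - H (w x) * divg χ x =
      divg (fun y => w y • h (w y) • χ y - H (w y) • χ y) x := by
    rw [divg_sub hwaχ hbχ, divg_smul hw haχ, divg_smul hb hχ, hD]
    simp only [smul_apply, PiLp.smul_apply, smul_eq_mul]
    ring
  rw [← sub_eq_zero, ← integral_sub]
  · simp only [key]
    refine integral_divg_eq_zero (hwaχ.sub hbχ) ?_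
    simp only [smul_smul, ← sub_smul]
    exact hcs _
  · exact integrable_continuous_mul_divg hw.continuous haχ (hcs _)
  · exact integrable_continuous_mul_divg hb.continuous hχ hc

/-- Smooth approximation of the positive part. -/
def smoothPosPart (k t : ℝ) : ℝ := (t + √(t ^ 2 + k ^ 2)) / 2

/-- The derivative of `smoothPosPart k`. -/
def smoothStep (k t : ℝ) : ℝ := (1 + t / √(t ^ 2 + k ^ 2)) / 2

lemma hasDerivAt_smoothPosPart {k : ℝ} (hk : 0 < k) (t : ℝ) :
    HasDerivAt (smoothPosPart k) (smoothStep k t) t := by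
  have h0 : t ^ 2 + k ^ 2 ≠ 0 := by positivity
  have h1 := ((hasDerivAt_pow 2 t).add_const (k ^ 2)).sqrt h0
  refine (((hasDerivAt_id t).add h1).div_const 2).congr_deriv ?_
  have hs : √(t ^ 2 + k ^ 2) ≠ 0 := by positivity
  simp only [smoothStep]
  field_simp
  push_cast
  ring

lemma contDiff_smoothStep {k : ℝ} (hk : 0 < k) : ContDiff ℝ 1 (smoothStep k) := by
  have h0 (t : ℝ) : t ^ 2 + k ^ 2 ≠ 0 := by positivity
  have h1 (t : ℝ) : √(t ^ 2 + k ^ 2) ≠ 0 := by positivity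
  have : ContDiff ℝ 1 fun t : ℝ => √(t ^ 2 + k ^ 2) := by fun_prop (disch := assumption)
  exact ((contDiff_const.add (contDiff_id.div this h1)).div_const 2)

lemma contDiff_smoothPosPart {k : ℝ} (hk : 0 < k) : ContDiff ℝ 1 (smoothPosPart k) := by
  have h0 (t : ℝ) : t ^ 2 + k ^ 2 ≠ 0 := by positivity
  have : ContDiff ℝ 1 fun t : ℝ => √(t ^ 2 + k ^ 2) := by fun_prop (disch := assumption)
  exact (contDiff_id.add this).div_const 2

lemma smoothStep_mem_Icc {k : ℝ} (hk : 0 < k) (t : ℝ) : smoothStep k t ∈ Icc (0 : ℝ) 1 := by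
  have hs : 0 < √(t ^ 2 + k ^ 2) := by positivity
  have habs : |t| ≤ √(t ^ 2 + k ^ 2) := Real.abs_le_sqrt (by nlinarith)
  have h1 : |t / √(t ^ 2 + k ^ 2)| ≤ 1 := by
    rw [abs_div, abs_of_pos hs]
    exact (div_le_one hs).2 habs
  have := abs_le.1 h1
  constructor <;> simp only [smoothStep] <;> linarith

lemma abs_smoothPosPart_sub_le {k : ℝ} (hk : 0 < k) (t : ℝ) :
    |smoothPosPart k t - max t 0| ≤ k := by
  have h1 : |t| ≤ √(t ^ 2 + k ^ 2) := Real.abs_le_sqrt (by nlinarith)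
  have h2 : √(t ^ 2 + k ^ 2) ≤ |t| + k := by
    rw [Real.sqrt_le_left (by positivity)]
    nlinarith [sq_abs t, abs_nonneg t]
  simp only [smoothPosPart]
  rcases le_total 0 t with h | h
  · rw [max_eq_left h]; rw [abs_of_nonneg h] at h1 h2
    rw [abs_le]; constructor <;> linarith
  · rw [max_eq_right h]; rw [abs_of_nonpos h] at h1 h2
    rw [abs_le]; constructor <;> linarith

lemma exists_pos_forall_dist_le {Ω K : Set Plane} {u : Plane → ℝ} (hu : ContinuousOn u Ω)
    (hK : IsCompact K) {r : ℝ} (hr : 0 < r) (hrΩ : cthickening r K ⊆ Ω) {ε : ℝ} (hε : 0 < ε) :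
    ∃ δ > 0, δ ≤ r ∧ ∀ x ∈ K, ∀ y ∈ ball x δ,
      dist (Ω.indicator u y) (Ω.indicator u x) ≤ ε := by
  obtain ⟨δ, hδ, h⟩ := Metric.uniformContinuousOn_iff.1
    ((hK.cthickening (r := r)).uniformContinuousOn_of_continuous (hu.mono hrΩ)) ε hε
  refine ⟨min δ r, lt_min hδ hr, min_le_right _ _, fun x hx y hy => ?_⟩
  have hxK : x ∈ cthickening r K := self_subset_cthickening K hx
  have hyK : y ∈ cthickening r K :=
    mem_cthickening_of_dist_le y x _ _ hx ((mem_ball.1 hy).le.trans (min_le_right _ _))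
  rw [indicator_of_mem (hrΩ hxK), indicator_of_mem (hrΩ hyK)]
  exact (h y hyK x hxK ((mem_ball.1 hy).trans_le (min_le_left _ _))).le

lemma setIntegral_mul_divg_eq {Ω : Set Plane} (hΩ : MeasurableSet Ω) {a b : Plane → ℝ}
    (hab : ∀ x ∈ Ω, a x = b x) {φ : Plane → Plane} (hφ : tsupport φ ⊆ Ω) :
    ∫ x in Ω, a x * divg φ x = ∫ x, b x * divg φ x := by
  rw [← integral_indicator hΩ]
  refine integral_congr_ae (ae_of_all _ fun x => ?_)
  by_cases hx : x ∈ Ω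
  · simp [hx, hab x hx]
  · simp [hx, divg_eq_zero_of_notMem_tsupport fun h => hx (hφ h)]

lemma integral_mul_divg_le_of_abs_sub_le {a b : Plane → ℝ} {φ : Plane → Plane} {ε : ℝ}
    (ha : Integrable fun x => a x * divg φ x) (hb : Integrable fun x => b x * divg φ x)
    (hφ : ContDiff ℝ 1 φ) (hc : HasCompactSupport φ)
    (hab : ∀ x ∈ tsupport φ, |a x - b x| ≤ ε) :
    ∫ x, a x * divg φ x ≤ (∫ x, b x * divg φ x) + ε * ∫ x, |divg φ x| := by
  have hd : Integrable fun x => |divg φ x| := (integrable_divg hφ hc).abs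
  rw [← integral_const_mul, ← integral_add hb (hd.const_mul ε)]
  refine integral_mono ha (hb.add (hd.const_mul ε)) fun x => ?_
  by_cases hx : x ∈ tsupport φ
  · have h1 := le_abs_self ((a x - b x) * divg φ x)
    rw [abs_mul] at h1
    have h2 := mul_le_mul_of_nonneg_right (hab x hx) (abs_nonneg (divg φ x))
    nlinarith
  · simp [divg_eq_zero_of_notMem_tsupport hx]

lemma norm_convexCombination_le {E : Type*} [SeminormedAddCommGroup E] [NormedSpace ℝ E]
    {a b : E} {t : ℝ} (ht : t ∈ Icc (0 : ℝ) 1) (ha : ‖a‖ ≤ 1) (hb : ‖b‖ ≤ 1) :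
    ‖b + t • (a - b)‖ ≤ 1 := by
  have := (convex_closedBall (0 : E) 1).add_smul_sub_mem (x := b) (y := a) (by simpa) (by simpa) ht
  simpa using this

lemma setIntegral_max_add_setIntegral_min_le {Ω : Set Plane} (hΩ : IsOpen Ω)
    {u v : Plane → ℝ} (hu : ContinuousOn u Ω) (hv : ContinuousOn v Ω)
    (hui : IntegrableOn u Ω) (hvi : IntegrableOn v Ω) {S T : ℝ}
    (hS : ∀ r ∈ TVtest Ω u, r ≤ S) (hT : ∀ r ∈ TVtest Ω v, r ≤ T)
    {r s : ℝ} (hr : r ∈ TVtest Ω fun x => max (u x) (v x))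
    (hs : s ∈ TVtest Ω fun x => min (u x) (v x)) : r + s ≤ S + T := by
  obtain ⟨φ, hφ, hφc, hφΩ, hφ1, rfl⟩ := hr
  obtain ⟨ψ, hψ, hψc, hψΩ, hψ1, rfl⟩ := hs
  set U := Ω.indicator u
  set V := Ω.indicator v
  have hU : Integrable U := hui.integrable_indicator hΩ.measurableSet
  have hV : Integrable V := hvi.integrable_indicator hΩ.measurableSet
  rw [setIntegral_mul_divg_eq hΩ.measurableSet (b := fun x => max (U x) (V x))
      (fun x hx => by simp [U, V, hx]) hφΩ,
    setIntegral_mul_divg_eq hΩ.measurableSet (b := fun x => min (U x) (V x))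
      (fun x hx => by simp [U, V, hx]) hψΩ]
  have hKc : IsCompact (tsupport φ ∪ tsupport ψ) := hφc.isCompact.union hψc.isCompact
  obtain ⟨r, hr, hrΩ⟩ := hKc.exists_cthickening_subset_open hΩ (union_subset hφΩ hψΩ)
  set C := (∫ x, |divg φ x|) + ∫ x, |divg ψ x| with hC
  have hC0 : 0 ≤ C := add_nonneg (integral_nonneg fun _ => abs_nonneg _)
    (integral_nonneg fun _ => abs_nonneg _)
  suffices key : ∀ ε > 0, (∫ x, max (U x) (V x) * divg φ x) + ∫ x, min (U x) (V x) * divg ψ x ≤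
      S + T + 4 * ε * C by
    refine le_of_forall_pos_le_add fun δ hδ => (key (δ / (4 * (C + 1))) (by positivity)).trans ?_
    gcongr
    field_simp
    linarith
  intro ε hε
  obtain ⟨δ₁, hδ₁, hδ₁r, h₁⟩ := exists_pos_forall_dist_le hu hKc hr hrΩ hε
  obtain ⟨δ₂, hδ₂, hδ₂r, h₂⟩ := exists_pos_forall_dist_le hv hKc hr hrΩ hε
  have hδ : 0 < min δ₁ δ₂ := lt_min hδ₁ hδ₂
  let ρ : ContDiffBump (0 : Plane) := ⟨min δ₁ δ₂ / 2, min δ₁ δ₂, half_pos hδ, half_lt_self hδ⟩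
  set a := ρ.normed volume ⋆[ContinuousLinearMap.lsmul ℝ ℝ, volume] U
  set b := ρ.normed volume ⋆[ContinuousLinearMap.lsmul ℝ ℝ, volume] V
  have ha : ContDiff ℝ 1 a := ρ.hasCompactSupport_normed.contDiff_convolution_left _
    ρ.contDiff_normed hU.locallyIntegrable
  have hb : ContDiff ℝ 1 b := ρ.hasCompactSupport_normed.contDiff_convolution_left _
    ρ.contDiff_normed hV.locallyIntegrable
  have haU : ∀ x ∈ tsupport φ ∪ tsupport ψ, |a x - U x| ≤ ε := fun x hx =>
    ρ.dist_normed_convolution_le hU.aestronglyMeasurable fun y hy =>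
      h₁ x hx y (ball_subset_ball (min_le_left _ _) hy)
  have hbV : ∀ x ∈ tsupport φ ∪ tsupport ψ, |b x - V x| ≤ ε := fun x hx =>
    ρ.dist_normed_convolution_le hV.aestronglyMeasurable fun y hy =>
      h₂ x hx y (ball_subset_ball (min_le_right _ _) hy)
  let H := smoothPosPart ε
  let h := smoothStep ε
  have hw : ContDiff ℝ 1 fun x => a x - b x := ha.sub hb
  have hh : ContDiff ℝ 1 fun x => h (a x - b x) := (contDiff_smoothStep hε).comp hw
  have hHw : ContDiff ℝ 1 fun x => H (a x - b x) := (contDiff_smoothPosPart hε).comp hw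
  let χ : Plane → Plane := fun x => φ x - ψ x
  have hχ : ContDiff ℝ 1 χ := hφ.sub hψ
  have hχc : HasCompactSupport χ := hφc.sub hψc
  let Z : Plane → Plane := fun x => h (a x - b x) • χ x
  have hZ : ContDiff ℝ 1 Z := hh.smul hχ
  have hZc : HasCompactSupport Z := hχc.smul_left (f := fun x => h (a x - b x))
  have hident := integral_mul_divg_comp_smul hw hχ hχc (contDiff_smoothStep hε)
    (contDiff_smoothPosPart hε) (hasDerivAt_smoothPosPart hε)
  change ∫ x, (a x - b x) * divg Z x = ∫ x, H (a x - b x) * divg χ x at hident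
  let X : Plane → Plane := fun x => ψ x + Z x
  let Y : Plane → Plane := fun x => φ x - Z x
  have hZsupp (x : Plane) (hx : x ∉ tsupport φ ∪ tsupport ψ) : φ x = 0 ∧ ψ x = 0 ∧ Z x = 0 := by
    have h1 : φ x = 0 := image_eq_zero_of_notMem_tsupport fun h => hx (.inl h)
    have h2 : ψ x = 0 := image_eq_zero_of_notMem_tsupport fun h => hx (.inr h)
    simp [Z, χ, h1, h2]
  have hsub {W : Plane → Plane} (hW : ∀ x ∉ tsupport φ ∪ tsupport ψ, W x = 0) :
      cthickening ρ.rOut (tsupport W) ⊆ Ω := by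
    refine (cthickening_subset_of_subset _ ?_).trans
      ((cthickening_mono ((min_le_left _ _).trans hδ₁r) _).trans hrΩ)
    refine closure_minimal (fun x hx => ?_) hKc.isClosed
    by_contra hxK
    exact hx (hW x hxK)
  have hXle : ∫ x, a x * divg X x ≤ S := by
    refine integral_convolution_mul_divg_le hΩ.measurableSet hui hS ρ (hψ.add hZ)
      (hψc.add hZc) (hsub fun x hx => ?_) fun x => ?_
    · simp [X, hZsupp x hx]
    · exact norm_convexCombination_le (smoothStep_mem_Icc hε _) (hφ1 x) (hψ1 x)
  have hYle : ∫ x, b x * divg Y x ≤ T := by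
    refine integral_convolution_mul_divg_le hΩ.measurableSet hvi hT ρ (hφ.sub hZ)
      (hφc.sub hZc) (hsub fun x hx => ?_) fun x => ?_
    · simp [Y, hZsupp x hx]
    · have := norm_convexCombination_le (smoothStep_mem_Icc hε (a x - b x)) (hψ1 x) (hφ1 x)
      rwa [← neg_sub (φ x), smul_neg, ← sub_eq_add_neg] at this
  let M : Plane → ℝ := fun x => b x + H (a x - b x)
  let m : Plane → ℝ := fun x => a x - H (a x - b x)
  have hM : Continuous M := hb.continuous.add hHw.continuous
  have hm : Continuous m := ha.continuous.sub hHw.continuous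
  have hMm : (∫ x, M x * divg φ x) + ∫ x, m x * divg ψ x =
      (∫ x, a x * divg X x) + ∫ x, b x * divg Y x := by
    have i1 := integrable_continuous_mul_divg hM hφ hφc
    have i2 := integrable_continuous_mul_divg hm hψ hψc
    have i3 : Integrable fun x => a x * divg X x :=
      integrable_continuous_mul_divg ha.continuous (hψ.add hZ) (hψc.add hZc)
    have i4 : Integrable fun x => b x * divg Y x :=
      integrable_continuous_mul_divg hb.continuous (hφ.sub hZ) (hφc.sub hZc)
    have i5 := integrable_continuous_mul_divg hw.continuous hZ hZc
    have i6 := integrable_continuous_mul_divg hHw.continuous hχ hχc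
    have i12 : Integrable fun x => M x * divg φ x + m x * divg ψ x := i1.add i2
    have i34 : Integrable fun x => a x * divg X x + b x * divg Y x := i3.add i4
    rw [← sub_eq_zero] at hident
    rw [← integral_add i1 i2, ← integral_add i3 i4, eq_comm, ← sub_eq_zero,
      ← integral_sub i34 i12, ← hident, ← integral_sub i5 i6]
    refine integral_congr_ae (ae_of_all _ fun x => ?_)
    simp only [X, Y, M, m, divg_add hψ hZ, divg_sub hφ hZ,
      show divg χ x = divg φ x - divg ψ x from divg_sub hφ hψ x]
    ring
  have hH (x : Plane) : |H (a x - b x) - max (a x - b x) 0| ≤ ε := abs_smoothPosPart_sub_le hε _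
  have hmaxsub (p q : ℝ) : max p q = q + max (p - q) 0 := by
    rw [← max_add_add_left]; simp
  have hminsub (p q : ℝ) : min p q = p - max (p - q) 0 := by
    have := min_add_max p q
    rw [hmaxsub p q] at this; linarith
  have hposclose (x : Plane) (hx : x ∈ tsupport φ ∪ tsupport ψ) :
      |max (U x - V x) 0 - max (a x - b x) 0| ≤ 2 * ε := by
    refine (abs_max_sub_max_le_abs _ _ _).trans ?_
    have := abs_le.1 (haU x hx)
    have := abs_le.1 (hbV x hx)
    rw [abs_le]; constructor <;> linarith
  have hmax := integral_mul_divg_le_of_abs_sub_le (ε := 4 * ε)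
    (integrable_mul_divg (hU.sup hV) hφ hφc) (integrable_continuous_mul_divg hM hφ hφc) hφ hφc
    fun x hx => by
      have h1 := abs_le.1 (hbV x (.inl hx))
      have h2 := abs_le.1 (hposclose x (.inl hx))
      have h3 := abs_le.1 (hH x)
      simp only [Pi.sup_apply, hmaxsub (U x), M]
      rw [abs_le]; constructor <;> linarith
  have hmin := integral_mul_divg_le_of_abs_sub_le (ε := 4 * ε)
    (integrable_mul_divg (hU.inf hV) hψ hψc) (integrable_continuous_mul_divg hm hψ hψc) hψ hψc
    fun x hx => by
      have h1 := abs_le.1 (haU x (.inr hx))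
      have h2 := abs_le.1 (hposclose x (.inr hx))
      have h3 := abs_le.1 (hH x)
      simp only [Pi.inf_apply, hminsub (U x), m]
      rw [abs_le]; constructor <;> linarith
  simp only [Pi.sup_apply, Pi.inf_apply] at hmax hmin
  rw [hC, mul_add]
  linarith

lemma zero_mem_TVtest (Ω : Set Plane) (u : Plane → ℝ) : (0 : ℝ) ∈ TVtest Ω u := by
  refine ⟨fun _ => 0, contDiff_const, HasCompactSupport.zero, ?_, by simp, by simp [divg]⟩
  simp [tsupport, Function.support]

lemma TVtest_congr {Ω : Set Plane} (hΩ : MeasurableSet Ω) {u v : Plane → ℝ}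
    (h : ∀ x ∈ Ω, u x = v x) : TVtest Ω u = TVtest Ω v := by
  have (φ : Plane → Plane) : ∫ x in Ω, u x * divg φ x = ∫ x in Ω, v x * divg φ x :=
    setIntegral_congr_fun hΩ fun x hx => by simp [h x hx]
  simp only [TVtest, this]

lemma BVOn.congr {Ω : Set Plane} (hΩ : MeasurableSet Ω) {u v : Plane → ℝ}
    (h : ∀ x ∈ Ω, u x = v x) (hu : BVOn u Ω) : BVOn v Ω :=
  ⟨hu.1.congr_fun h hΩ, TVtest_congr hΩ h ▸ hu.2⟩

lemma totalVar_congr {Ω : Set Plane} (hΩ : MeasurableSet Ω) {u v : Plane → ℝ}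
    (h : ∀ x ∈ Ω, u x = v x) : totalVar Ω u = totalVar Ω v := by
  rw [totalVar, totalVar, TVtest_congr hΩ h]

lemma TVtest_add_const {Ω : Set Plane} {u : Plane → ℝ} (hΩ : MeasurableSet Ω)
    (hu : IntegrableOn u Ω) (c : ℝ) : TVtest Ω (fun x => u x + c) = TVtest Ω u := by
  ext r
  refine exists_congr fun φ => and_congr_right fun hφ => and_congr_right fun hc =>
    and_congr_right fun hs => and_congr_right fun _ => ?_
  have hconst : ∫ x in Ω, c * divg φ x = 0 := by
    rw [setIntegral_mul_divg_eq hΩ (fun _ _ => rfl) hs, integral_const_mul,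
      integral_divg_eq_zero hφ hc, mul_zero]
  simp only [add_mul]
  rw [integral_add (integrable_mul_divg hu hφ hc)
    ((integrable_divg hφ hc).const_mul c).integrableOn, hconst, add_zero]

lemma BVOn.add_const {Ω : Set Plane} {u : Plane → ℝ} (hΩ : MeasurableSet Ω)
    (hΩb : Bornology.IsBounded Ω) (hu : BVOn u Ω) (c : ℝ) : BVOn (fun x => u x + c) Ω :=
  ⟨hu.1.add (integrableOn_const hΩb.measure_lt_top.ne), (TVtest_add_const hΩ hu.1 c).symm ▸ hu.2⟩

lemma totalVar_add_const {Ω : Set Plane} {u : Plane → ℝ} (hΩ : MeasurableSet Ω)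
    (hu : IntegrableOn u Ω) (c : ℝ) : totalVar Ω (fun x => u x + c) = totalVar Ω u := by
  rw [totalVar, totalVar, TVtest_add_const hΩ hu]

lemma BVOn.sub {Ω : Set Plane} {u v : Plane → ℝ} (hu : BVOn u Ω) (hv : BVOn v Ω) :
    BVOn (fun x => u x - v x) Ω := by
  refine ⟨hu.1.sub hv.1, totalVar Ω u + totalVar Ω v, ?_⟩
  rintro _ ⟨φ, hφ, hc, hs, h1, rfl⟩
  have h2 : -∫ x in Ω, v x * divg φ x ∈ TVtest Ω v := by
    refine ⟨fun x => -φ x, hφ.neg, hc.neg, ?_, by simpa using h1, ?_⟩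
    · simpa [tsupport, Function.support] using hs
    · simp [divg_neg, integral_neg]
  have h3 := le_csSup hu.2 (show _ ∈ TVtest Ω u from ⟨φ, hφ, hc, hs, h1, rfl⟩)
  have h4 := le_csSup hv.2 h2
  simp only [sub_mul]
  rw [integral_sub (integrable_mul_divg hu.1 hφ hc) (integrable_mul_divg hv.1 hφ hc),
    sub_eq_add_neg]
  exact add_le_add h3 h4

section Submodularity

variable {Ω : Set Plane} {u v : Plane → ℝ}

lemma add_le_totalVar_add_totalVar (hΩ : IsOpen Ω) (huc : ContinuousOn u Ω)
    (hvc : ContinuousOn v Ω) (hu : BVOn u Ω) (hv : BVOn v Ω) {r s : ℝ}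
    (hr : r ∈ TVtest Ω fun x => max (u x) (v x)) (hs : s ∈ TVtest Ω fun x => min (u x) (v x)) :
    r + s ≤ totalVar Ω u + totalVar Ω v :=
  setIntegral_max_add_setIntegral_min_le hΩ huc hvc hu.1 hv.1 (fun _ h => le_csSup hu.2 h)
    (fun _ h => le_csSup hv.2 h) hr hs

lemma BVOn.max (hΩ : IsOpen Ω) (huc : ContinuousOn u Ω) (hvc : ContinuousOn v Ω)
    (hu : BVOn u Ω) (hv : BVOn v Ω) : BVOn (fun x => max (u x) (v x)) Ω := by
  refine ⟨hu.1.sup hv.1, totalVar Ω u + totalVar Ω v, fun r hr => ?_⟩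
  simpa using add_le_totalVar_add_totalVar hΩ huc hvc hu hv hr (zero_mem_TVtest _ _)

/-- The total variation is submodular. -/
lemma totalVar_max_add_totalVar_min_le (hΩ : IsOpen Ω) (huc : ContinuousOn u Ω)
    (hvc : ContinuousOn v Ω) (hu : BVOn u Ω) (hv : BVOn v Ω) :
    totalVar Ω (fun x => max (u x) (v x)) + totalVar Ω (fun x => min (u x) (v x)) ≤
      totalVar Ω u + totalVar Ω v := by
  rw [← le_sub_iff_add_le]
  refine csSup_le ⟨0, zero_mem_TVtest _ _⟩ fun r hr => ?_
  rw [le_sub_comm]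
  refine csSup_le ⟨0, zero_mem_TVtest _ _⟩ fun s hs => ?_
  rw [le_sub_iff_add_le, add_comm]
  exact add_le_totalVar_add_totalVar hΩ huc hvc hu hv hr hs

end Submodularity

lemma HasTraceOn.eq_of_mem_frontier {Ω : Set Plane} {u f : Plane → ℝ} (h : HasTraceOn u Ω f)
    (hu : ContinuousOn u (closure Ω)) {p : Plane} (hp : p ∈ frontier Ω) : u p = f p :=
  haveI := mem_closure_iff_nhdsWithin_neBot.1 (frontier_subset_closure hp)
  tendsto_nhds_unique ((hu p (frontier_subset_closure hp)).mono_left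
    (nhdsWithin_mono p subset_closure)) (h p hp)

/-- Lowering `u` to `min u (v + ε)` is a compactly supported perturbation when `u ≤ v` on the
boundary, and it preserves the least gradient property. -/
lemma le_add_of_leastGradientOn {Ω : Set Plane} (hΩ : IsOpen Ω) (hΩb : Bornology.IsBounded Ω)
    {u v f g : Plane → ℝ} (hu : LeastGradientOn u Ω) (huc : ContinuousOn u (closure Ω))
    (huf : HasTraceOn u Ω f) (hv : LeastGradientOn v Ω) (hvc : ContinuousOn v (closure Ω))
    (hvg : HasTraceOn v Ω g) (hfg : ∀ x ∈ frontier Ω, f x ≤ g x)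
    (huniq : ∀ w : Plane → ℝ, LeastGradientOn w Ω → ContinuousOn w (closure Ω) →
      HasTraceOn w Ω f → ∀ x ∈ Ω, u x = w x)
    {ε : ℝ} (hε : 0 < ε) : ∀ x ∈ Ω, u x ≤ v x + ε := by
  have hΩm := hΩ.measurableSet
  have huΩ := huc.mono subset_closure
  have hvΩ : ContinuousOn (fun x => v x + ε) Ω :=
    (hvc.mono subset_closure).add continuousOn_const
  have hvε := hv.1.add_const hΩm hΩb ε
  have hsubm := totalVar_max_add_totalVar_min_le hΩ huΩ hvΩ hu.1 hvε
  rw [totalVar_add_const hΩm hv.1.1] at hsubm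
  have hmaxBV := hu.1.max hΩ huΩ hvΩ hvε
  set p : Plane → ℝ := Ω.indicator fun x => max (u x - v x - ε) 0
  have hpcl : EqOn p (fun x => max (u x - v x - ε) 0) (closure Ω) := by
    intro x hx
    by_cases hxΩ : x ∈ Ω
    · simp [p, hxΩ]
    · have hxf : x ∈ frontier Ω := by rw [hΩ.frontier_eq]; exact ⟨hx, hxΩ⟩
      have h1 := huf.eq_of_mem_frontier huc hxf
      have h2 := hvg.eq_of_mem_frontier hvc hxf
      have h3 := hfg x hxf
      simp only [p, indicator_of_notMem hxΩ]
      rw [max_eq_right (by linarith)]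
  have hpmax (x : Plane) (hx : x ∈ Ω) : p x = max (u x) (v x + ε) - (v x + ε) := by
    rw [hpcl (subset_closure hx), ← max_sub_sub_right]
    simp [sub_sub]
  have hpmin (x : Plane) (hx : x ∈ Ω) : u x - p x = min (u x) (v x + ε) := by
    have := min_add_max (u x) (v x + ε)
    rw [hpmax x hx]; linarith
  have hpBV : BVOn p Ω := (hmaxBV.sub hvε).congr hΩm fun x hx => (hpmax x hx).symm
  have hpsupp : tsupport p ⊆ {x ∈ closure Ω | ε ≤ u x - v x} := by
    refine closure_minimal (fun x hx => ?_)
      ((huc.sub hvc).preimage_isClosed_of_isClosed isClosed_closure isClosed_Ici)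
    have hxΩ : x ∈ Ω := by
      by_contra h
      exact hx (indicator_of_notMem h _)
    refine ⟨subset_closure hxΩ, ?_⟩
    by_contra! h
    refine hx ?_
    change u x - v x < ε at h
    rw [hpcl (subset_closure hxΩ)]
    exact max_eq_right (by linarith)
  have hpsuppΩ : tsupport p ⊆ Ω := by
    intro x hx
    obtain ⟨hxc, hxε⟩ := hpsupp hx
    by_contra hxΩ
    have hxf : x ∈ frontier Ω := by rw [hΩ.frontier_eq]; exact ⟨hxc, hxΩ⟩
    have h1 := huf.eq_of_mem_frontier huc hxf
    have h2 := hvg.eq_of_mem_frontier hvc hxf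
    have h3 := hfg x hxf
    linarith
  have hpc : HasCompactSupport p :=
    hΩb.isCompact_closure.of_isClosed_subset (isClosed_tsupport p)
      (hpsuppΩ.trans subset_closure)
  have hvle : totalVar Ω v ≤ totalVar Ω fun x => max (u x) (v x + ε) := by
    refine (hv.2 p hpBV hpc hpsuppΩ).trans_eq ?_
    rw [← totalVar_add_const hΩm (hmaxBV.1) (-ε)]
    refine totalVar_congr hΩm fun x hx => ?_
    rw [Pi.add_apply, hpmax x hx]
    ring
  set w : Plane → ℝ := fun x => u x - p x
  have hwle : totalVar Ω w ≤ totalVar Ω u := by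
    rw [totalVar_congr hΩm hpmin]
    linarith
  have hwc : ContinuousOn w (closure Ω) := by
    refine huc.sub (ContinuousOn.congr ?_ hpcl)
    exact ((huc.sub hvc).sub continuousOn_const).sup continuousOn_const
  have hwLG : LeastGradientOn w Ω := by
    refine ⟨hu.1.sub hpBV, fun χ hχ hχc hχΩ => hwle.trans ?_⟩
    have hsum : w + χ = u + fun x => χ x - p x := by
      ext x; simp only [w, Pi.add_apply]; ring
    have hsub : tsupport (fun x => χ x - p x) ⊆ Ω :=
      (tsupport_sub χ p).trans (union_subset hχΩ hpsuppΩ)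
    rw [hsum]
    exact hu.2 _ (hχ.sub hpBV) (hχc.sub hpc) hsub
  have hwf : HasTraceOn w Ω f := by
    intro q hq
    have hqc := frontier_subset_closure hq
    have hqΩ : q ∉ Ω := by rw [hΩ.frontier_eq] at hq; exact hq.2
    have : w q = f q := by
      simp [w, p, hqΩ, huf.eq_of_mem_frontier huc hq]
    rw [← this]
    exact (hwc q hqc).mono_left (nhdsWithin_mono q subset_closure)
  intro x hx
  rw [huniq w hwLG hwc hwf x hx]
  exact (hpmin x hx).trans_le (min_le_right _ _)

/-- Comparison principle: if `f₁ ≤ f₂` are continuous admissible boundary data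
on a bounded convex `Ω` and `u₁, u₂` are the corresponding solutions obtained
as pointwise limits of the (unique, continuous) least gradient solutions on
strictly convex approximating domains `Ω'ₙ ⊇ Ω` with ordered data, then
`u₁ ≤ u₂` on `Ω`. -/
theorem comparison_principle
    (Ω : Set Plane) (hΩo : IsOpen Ω) (hΩb : Bornology.IsBounded Ω)
    (hΩc : Convex ℝ Ω)
    (f₁ f₂ : Plane → ℝ)
    (hf₁ : ContinuousOn f₁ (frontier Ω)) (hf₂ : ContinuousOn f₂ (frontier Ω))
    (hle : ∀ x ∈ frontier Ω, f₁ x ≤ f₂ x)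
    -- strictly convex approximating domains
    (Ω' : ℕ → Set Plane)
    (hΩ'o : ∀ n, IsOpen (Ω' n)) (hΩ'b : ∀ n, Bornology.IsBounded (Ω' n))
    (hΩ'sc : ∀ n, StrictConvex ℝ (closure (Ω' n)))
    (hΩ'sub : ∀ n, Ω ⊆ Ω' n)
    (hH : Tendsto (fun n => hausdorffDist (closure (Ω' n)) (closure Ω))
      atTop (𝓝 0))
    -- approximating ordered boundary data and the corresponding solutions
    (f₁' f₂' : ℕ → Plane → ℝ)
    (hle' : ∀ n, ∀ x ∈ frontier (Ω' n), f₁' n x ≤ f₂' n x)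
    (v₁ v₂ : ℕ → Plane → ℝ)
    (hv₁ : ∀ n, LeastGradientOn (v₁ n) (Ω' n) ∧
      ContinuousOn (v₁ n) (closure (Ω' n)) ∧ HasTraceOn (v₁ n) (Ω' n) (f₁' n))
    (hv₂ : ∀ n, LeastGradientOn (v₂ n) (Ω' n) ∧
      ContinuousOn (v₂ n) (closure (Ω' n)) ∧ HasTraceOn (v₂ n) (Ω' n) (f₂' n))
    -- uniqueness of solutions on the strictly convex domains
    (huniq : ∀ n, ∀ w₁ w₂ : Plane → ℝ,
      LeastGradientOn w₁ (Ω' n) → ContinuousOn w₁ (closure (Ω' n)) →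
      HasTraceOn w₁ (Ω' n) (f₁' n) →
      LeastGradientOn w₂ (Ω' n) → ContinuousOn w₂ (closure (Ω' n)) →
      HasTraceOn w₂ (Ω' n) (f₁' n) → ∀ x ∈ Ω' n, w₁ x = w₂ x)
    -- `u₁`, `u₂` are pointwise limits of the approximate solutions on `Ω`
    (u₁ u₂ : Plane → ℝ)
    (hlim₁ : ∀ x ∈ Ω, Tendsto (fun n => v₁ n x) atTop (𝓝 (u₁ x)))
    (hlim₂ : ∀ x ∈ Ω, Tendsto (fun n => v₂ n x) atTop (𝓝 (u₂ x))) :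
    ∀ x ∈ Ω, u₁ x ≤ u₂ x := by
  intro x hx
  refine le_of_tendsto_of_tendsto' (hlim₁ x hx) (hlim₂ x hx) fun n =>
    le_of_forall_pos_le_add fun ε hε => ?_
  obtain ⟨h₁, hc₁, ht₁⟩ := hv₁ n
  obtain ⟨h₂, hc₂, ht₂⟩ := hv₂ n
  exact le_add_of_leastGradientOn (hΩ'o n) (hΩ'b n) h₁ hc₁ ht₁ h₂ hc₂ ht₂ (hle' n)
    (fun w hw hwc hwt => huniq n _ w h₁ hc₁ ht₁ hw hwc hwt) hε x (hΩ'sub n hx)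
end
end
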